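/- For all integers n, k with k ≥ 2 and n ≥ 1, writing q = ⌊n/(k−1)⌋, the following identity of partitions holds: (ρ_n +_H ((k−1)_V ρ_q)) +_V ( +_H_{i=0}^{k−1} ρ_{⌊(n+q+1+i)/k⌋} ) = ρ_{n+q+1}, where the inner sum is the horizontal sum over i = 0, 1, …, k−1. -/

import Mathlib

/-- A partition, encoded by its weakly decreasing (0-indexed) sequence of parts,
eventually zero.  The horizontal sum `+_H` is pointwise addition of part functions. -/
def IsPtnFun (f : ℕ → ℕ) : Prop :=
  Antitone f ∧ ∃ N, ∀ i, N ≤ i → f i = 0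

/-- The staircase partition `ρ_m = (m, m-1, …, 1)`. -/
def rho (m : ℕ) : ℕ → ℕ := fun i => m - i

/-- The conjugate partition: `(conjFun f) j = #{i : f i ≥ j + 1}`. -/
noncomputable def conjFun (f : ℕ → ℕ) : ℕ → ℕ := fun j => {i | j + 1 ≤ f i}.ncard

/-- The vertical sum `λ +_V μ = (λ' +_H μ')'`. -/
noncomputable def vsum (f g : ℕ → ℕ) : ℕ → ℕ := conjFun (conjFun f + conjFun g)

/-- `vmul k λ = k_V λ`, the vertical sum of `k` copies of `λ`. -/
noncomputable def vmul : ℕ → (ℕ → ℕ) → (ℕ → ℕ)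
  | 0, _ => 0
  | k + 1, f => vsum f (vmul k f)

theorem conjFun_eq_of_iff {f : ℕ → ℕ} {j c : ℕ} (h : ∀ i, j + 1 ≤ f i ↔ i < c) :
    conjFun f j = c := by
  have : {i | j + 1 ≤ f i} = (Finset.range c : Set ℕ) := by
    ext i
    simpa using h i
  rw [conjFun, this, Set.ncard_coe_finset, Finset.card_range]

theorem conjFun_rho (m : ℕ) : conjFun (rho m) = rho m := by
  funext j
  exact conjFun_eq_of_iff fun i => by simp only [rho]; omega

theorem conjFun_zero : conjFun 0 = 0 := by
  funext j
  exact conjFun_eq_of_iff fun i => by simp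

theorem conjFun_sub_div {m : ℕ} (hm : 0 < m) (q : ℕ) :
    conjFun (fun i => q - i / m) = fun j => m * (q - j) := by
  funext j
  refine conjFun_eq_of_iff fun i => ?_
  rw [mul_comm, ← Nat.div_lt_iff_lt_mul hm]
  generalize i / m = d
  omega

theorem conjFun_mul_sub {m : ℕ} (hm : 0 < m) (q : ℕ) :
    conjFun (fun j => m * (q - j)) = fun i => q - i / m := by
  funext j
  refine conjFun_eq_of_iff fun i => ?_
  rw [Nat.succ_le_iff, mul_comm, ← Nat.div_lt_iff_lt_mul hm]
  generalize j / m = d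
  omega

theorem vmul_rho {m : ℕ} (hm : 0 < m) (q : ℕ) :
    vmul m (rho q) = fun i => q - i / m := by
  induction m, hm using Nat.le_induction with
  | base =>
    simp only [vmul, vsum, conjFun_zero, add_zero, conjFun_rho, Nat.div_one]
    rfl
  | succ m hm ih =>
    rw [vmul, ih, vsum, conjFun_rho, conjFun_sub_div hm, ← conjFun_mul_sub m.succ_pos]
    congr 1
    funext j
    simp only [Pi.add_apply, rho, Nat.succ_mul, add_comm]

/-- Hermite's identity for natural numbers. -/
theorem sum_range_add_div {k : ℕ} (hk : 0 < k) (a : ℕ) :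
    ∑ i ∈ Finset.range k, (a + i) / k = a := by
  induction a with
  | zero =>
    refine Finset.sum_eq_zero fun i hi => ?_
    rw [zero_add, Nat.div_eq_of_lt (Finset.mem_range.mp hi)]
  | succ a ih =>
    have h := Finset.sum_range_succ' (fun i => (a + i) / k) k
    rw [Finset.sum_range_succ, ih, Nat.add_div_right _ hk] at h
    have h' : ∑ i ∈ Finset.range k, (a + 1 + i) / k =
        ∑ i ∈ Finset.range k, (a + (i + 1)) / k :=
      Finset.sum_congr rfl fun i _ => by rw [add_assoc, add_comm 1 i]
    rw [h']
    simp only [add_zero] at h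
    omega

theorem sum_rho_add_div {k : ℕ} (hk : 0 < k) (a : ℕ) :
    ∑ i ∈ Finset.range k, rho ((a + i) / k) = fun j => a - k * j := by
  funext j
  rw [Finset.sum_apply]
  simp only [rho]
  rcases le_total (k * j) a with h | h
  · obtain ⟨b, rfl⟩ := Nat.exists_eq_add_of_le h
    rw [Nat.add_sub_cancel_left]
    conv_rhs => rw [← sum_range_add_div hk b]
    refine Finset.sum_congr rfl fun i _ => ?_
    rw [add_assoc, Nat.mul_add_div hk, Nat.add_sub_cancel_left]
  · rw [Nat.sub_eq_zero_of_le h]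
    refine Finset.sum_eq_zero fun i hi => ?_
    have : (a + i) / k < j + 1 := by
      rw [Nat.div_lt_iff_lt_mul hk, add_mul, mul_comm j k]
      have := Finset.mem_range.mp hi
      omega
    omega

theorem rho_add_sub_div {m : ℕ} (n : ℕ) :
    (rho n + fun i => n / m - i / m) = fun i => n + n / m + 1 - (i + i / m + 1) := by
  funext i
  simp only [Pi.add_apply, rho]
  rcases le_total i n with h | h
  · have := Nat.div_le_div_right (c := m) h
    omega
  · have := Nat.div_le_div_right (c := m) h
    omega

theorem ncard_lt_add_ncard_lt {a b : ℕ → ℕ} (ha : a.Injective) (hb : b.Injective)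
    (hab : IsCompl (Set.range a) (Set.range b)) (c : ℕ) :
    {i | a i < c}.ncard + {i | b i < c}.ncard = c := by
  have hd : Disjoint (a '' {i | a i < c}) (b '' {i | b i < c}) :=
    hab.disjoint.mono (Set.image_subset_range _ _) (Set.image_subset_range _ _)
  have hu : a '' {i | a i < c} ∪ b '' {i | b i < c} = (Finset.range c : Set ℕ) := by
    ext x
    have hx : x ∈ Set.range a ∪ Set.range b := hab.sup_eq_top.ge (Set.mem_univ x)
    simp only [Set.mem_union, Set.mem_image, Set.mem_ofPred_eq, Finset.coe_range, Set.mem_Iio]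
    constructor
    · rintro (⟨i, hi, rfl⟩ | ⟨i, hi, rfl⟩) <;> exact hi
    · intro h
      rcases hx with ⟨i, rfl⟩ | ⟨i, rfl⟩
      exacts [.inl ⟨i, h, rfl⟩, .inr ⟨i, h, rfl⟩]
  have hf : (a '' {i | a i < c} ∪ b '' {i | b i < c}).Finite := hu ▸ Finset.finite_toSet _
  rw [← Set.ncard_image_of_injective {i | a i < c} ha,
    ← Set.ncard_image_of_injective {i | b i < c} hb,
    ← Set.ncard_union_eq hd (hf.subset Set.subset_union_left) (hf.subset Set.subset_union_right),
    hu, Set.ncard_coe_finset, Finset.card_range]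

theorem vsum_sub_sub {a b : ℕ → ℕ} (ha : a.Injective) (hb : b.Injective)
    (hab : IsCompl (Set.range a) (Set.range b)) (c : ℕ) :
    vsum (fun i => c - a i) (fun i => c - b i) = rho c := by
  have h : conjFun (fun i => c - a i) + conjFun (fun i => c - b i) = rho c := by
    funext j
    rw [rho, ← ncard_lt_add_ncard_lt ha hb hab (c - j)]
    simp only [Pi.add_apply, conjFun]
    congr 2 <;> ext i <;> simp only [Set.mem_ofPred_eq] <;> omega
  rw [vsum, h, conjFun_rho]

theorem add_div_add_one_injective (m : ℕ) :
    Function.Injective fun i : ℕ => i + i / m + 1 := by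
  refine StrictMono.injective fun i j h => ?_
  have := Nat.div_le_div_right (c := m) h.le
  grind

theorem isCompl_range_add_div_range_mul {m : ℕ} (hm : 0 < m) :
    IsCompl (Set.range fun i : ℕ => i + i / m + 1)
      (Set.range fun i : ℕ => (m + 1) * i) := by
  have key (i : ℕ) : i + i / m + 1 = (m + 1) * (i / m) + (i % m + 1) := by
    have := Nat.div_add_mod i m
    rw [add_mul]
    omega
  rw [isCompl_iff, codisjoint_iff, Set.disjoint_left]
  constructor
  · rintro _ ⟨i, rfl⟩ ⟨j, hj⟩
    dsimp only at hj
    rw [key] at hj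
    have h := congrArg (· % (m + 1)) hj
    have := Nat.mod_lt i hm
    simp only [Nat.mul_mod_right, Nat.mul_add_mod] at h
    rw [Nat.mod_eq_of_lt (by omega)] at h
    omega
  · refine Set.eq_univ_iff_forall.mpr fun x => ?_
    have hx := Nat.div_add_mod x (m + 1)
    have hlt := Nat.mod_lt x (Nat.add_one_pos m)
    rcases Nat.eq_zero_or_pos (x % (m + 1)) with h | h
    · exact .inr ⟨x / (m + 1), by dsimp only; omega⟩
    · have hr : x % (m + 1) - 1 < m := by omega
      refine .inl ⟨m * (x / (m + 1)) + (x % (m + 1) - 1), ?_⟩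
      dsimp only
      rw [key, Nat.mul_add_div hm, Nat.mul_add_mod, Nat.div_eq_of_lt hr, Nat.mod_eq_of_lt hr,
        add_zero]
      omega

/-- For `k ≥ 2` and `n ≥ 1`, with `q = ⌊n/(k-1)⌋`:
`(ρ_n +_H ((k-1)_V ρ_q)) +_V (+_H_{i=0}^{k-1} ρ_{⌊(n+q+1+i)/k⌋}) = ρ_{n+q+1}`. -/
theorem staircase_layer_identity_two (n k : ℕ) (hk : 2 ≤ k) (hn : 1 ≤ n) :
    vsum (rho n + vmul (k - 1) (rho (n / (k - 1))))
        (∑ i ∈ Finset.range k, rho ((n + n / (k - 1) + 1 + i) / k))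
      = rho (n + n / (k - 1) + 1) := by
  obtain ⟨m, rfl⟩ : ∃ m, k = m + 1 := ⟨k - 1, by omega⟩
  have hm : 0 < m := by omega
  rw [Nat.add_sub_cancel, vmul_rho hm, rho_add_sub_div, sum_rho_add_div m.succ_pos]
  exact vsum_sub_sub (add_div_add_one_injective m)
    (mul_right_injective₀ m.succ_ne_zero) (isCompl_range_add_div_range_mul hm) _
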